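/- Consider a controllability radio connectivity graph G_R with scheduling η_R of period Π and slot duration Δ, with the data-flow semantics, all node variables initialized to 0 and ũ(kT) = 0 for k < 0. Then at the end of each scheduling period every node's variable equals the sum of the contributions of all paths from the controller node to it: for every node v_j ≠ v_c and every k ≥ 0, μ_j(kT) = Σ_ρ W_R(ρ) · μ_c((k − δ_R(ρ))T), where the sum ranges over all paths ρ from v_c to v_j in G_R(η_R), W_R(ρ) is the product of the weights of the edges of ρ, and δ_R(ρ) is the delay of ρ under η_R. -/

import Mathlib

noncomputable section

namespace MCNPaper

variable {V : Type} [Fintype V] [DecidableEq V]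

/-- `ρ` is a path from `a` to `b` (with at least one edge) whose consecutive
vertex pairs are all edges in the edge set `S`. -/
def IsPathIn (S : Set (V × V)) (a b : V) (ρ : List V) : Prop :=
  ρ.head? = some a ∧ ρ.getLast? = some b ∧ 2 ≤ ρ.length ∧
    List.Chain' (fun u v => (u, v) ∈ S) ρ

/-- A radio connectivity graph: a finite directed acyclic graph with positive
weights on edges and distinguished source (controller resp. sensor) and
destination (actuator resp. controller) nodes. -/
structure RadioGraph (V : Type) [Fintype V] [DecidableEq V] where
  E : Finset (V × V)
  W : V × V → ℝ
  vsrc : V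
  vdst : V
  W_pos : ∀ e ∈ E, 0 < W e
  acyclic : ∀ (v : V) (ρ : List V), ¬ IsPathIn (↑E : Set (V × V)) v v ρ

/-- A communication scheduling of period `Per` on edge set `E`: each slot is a
set of edges of `E`, only slots `1,…,Per` are used, and every edge is scheduled
in at most one slot per period. -/
def ValidSched (E : Finset (V × V)) (Per : ℕ) (η : ℕ → Finset (V × V)) : Prop :=
  (∀ k, η k ⊆ E) ∧ (∀ k, η k ≠ ∅ → 1 ≤ k ∧ k ≤ Per) ∧
    (∀ e k k', e ∈ η k → e ∈ η k' → k = k')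

/-- Edge set of the subgraph `G(η)`: union of all scheduled slots. -/
def schedUnion (η : ℕ → Finset (V × V)) : Set (V × V) := ⋃ k, (↑(η k) : Set (V × V))

/-- The list of consecutive edges of a path given as a list of vertices. -/
def pathEdges (ρ : List V) : List (V × V) := ρ.zip ρ.tail

/-- Weight of a path: product of the weights of its edges. -/
def pathWeight (W : V × V → ℝ) (ρ : List V) : ℝ := ((pathEdges ρ).map W).prod

/-- The slot in which an edge is scheduled (an edge is scheduled at most once
per period, so this is the unique such slot when it exists). -/
def slot (η : ℕ → Finset (V × V)) (e : V × V) : ℕ := sInf {k | e ∈ η k}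

/-- Delay (in scheduling periods) of a path under the scheduling `η`:
`δ(ρ) = 1 + #{ j : t_{j+1} ≤ t_j }` where `t_1,…,t_m` are the slots of the
consecutive edges of `ρ`. -/
def pathDelay (η : ℕ → Finset (V × V)) (ρ : List V) : ℕ :=
  1 + (((pathEdges ρ).map (slot η)).zip ((pathEdges ρ).map (slot η)).tail).countP
        (fun p => decide (p.2 ≤ p.1))

/-- `χ`: the set of paths from `a` to `b` in the subgraph `G(η)`. -/
def chi (η : ℕ → Finset (V × V)) (a b : V) : Set (List V) :=
  {ρ | IsPathIn (schedUnion η) a b ρ}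

/-- `χ(i)`: the set of paths from `a` to `b` in `G(η)` of delay `i`. -/
def chiDelay (η : ℕ → Finset (V × V)) (a b : V) (i : ℕ) : Set (List V) :=
  {ρ | IsPathIn (schedUnion η) a b ρ ∧ pathDelay η ρ = i}

/-- `γ(i)`: sum of the weights of all paths from `a` to `b` of delay `i`
(an empty sum being `0`). -/
def gamma (W : V × V → ℝ) (η : ℕ → Finset (V × V)) (a b : V) (i : ℕ) : ℝ :=
  ∑ᶠ ρ ∈ chiDelay η a b i, pathWeight W ρ

/-- `D`: the length (number of edges) of a longest path from `a` to `b` in `G(η)`. -/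
def Dmax (η : ℕ → Finset (V × V)) (a b : V) : ℕ :=
  sSup {m | ∃ ρ, IsPathIn (schedUnion η) a b ρ ∧ m = ρ.length - 1}

/-- The graph is jointly connected by `η` if `G(η)` contains a path from `a` to `b`. -/
def JointlyConnected (η : ℕ → Finset (V × V)) (a b : V) : Prop :=
  ∃ ρ, IsPathIn (schedUnion η) a b ρ

end MCNPaper

namespace MCNPaper

variable {V : Type} [Fintype V] [DecidableEq V]

/-- Data-flow semantics: `flow E W Per η vc ut h e` is the value `μ̄_{i,j}` carried at
global time-slot `h` by the destination node of the edge `e = (v_i, v_j)` for its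
incoming edge `e`.  All variables are initialized to `0`.  Global slot `h` belongs to
scheduling period `h / Per`, and the slot of the period being executed between global
times `h` and `h+1` is `h % Per + 1 ∈ {1,…,Per}`.  At each slot, if the edge is
scheduled then its variable is updated with the weighted value of its source node
(which is `ũ` of the current period for the controller node `vc`, and the sum of the
incoming-edge variables otherwise); otherwise the variable is held. -/
def flow (E : Finset (V × V)) (W : V × V → ℝ) (Per : ℕ) (η : ℕ → Finset (V × V))
    (vc : V) (ut : ℤ → ℝ) : ℕ → V × V → ℝ
  | 0 => fun _ => 0
  | h + 1 => fun e =>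
      if e ∈ η (h % Per + 1) then
        W e * (if e.1 = vc then ut ((h / Per : ℕ) : ℤ)
               else ∑ u ∈ Finset.univ.filter (fun u => (u, e.1) ∈ E),
                      flow E W Per η vc ut h (u, e.1))
      else flow E W Per η vc ut h e

/-- The value `μ_v(h)` of node `v` at global time-slot `h`: the controller node holds
the control command `ũ` of the current period, every other node holds the sum of the
variables associated with its incoming edges. -/
def nodeVal (E : Finset (V × V)) (W : V × V → ℝ) (Per : ℕ) (η : ℕ → Finset (V × V))
    (vc : V) (ut : ℤ → ℝ) (h : ℕ) (v : V) : ℝ :=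
  if v = vc then ut ((h / Per : ℕ) : ℤ)
  else ∑ u ∈ Finset.univ.filter (fun u => (u, v) ∈ E), flow E W Per η vc ut h (u, v)

end MCNPaper

namespace MCNPaper

/-- Paths from `a` to `b` with edges in `S`, including the one-vertex path when `a = b`. -/
def walks {V : Type} (S : Set (V × V)) (a b : V) : Set (List V) :=
  {ρ | ρ.head? = some a ∧ ρ.getLast? = some b ∧ ρ.IsChain (fun u v => (u, v) ∈ S)}

theorem zip_tail_append_pair {α : Type*} (l : List α) (a b : α) :
    (l ++ [a, b]).zip (l ++ [a, b]).tail = (l ++ [a]).zip (l ++ [a]).tail ++ [(a, b)] := by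
  induction l with
  | nil => simp
  | cons x l ih => cases l <;> simp_all

variable {V : Type}

theorem pathEdges_append_pair (l : List V) (a b : V) :
    pathEdges (l ++ [a, b]) = pathEdges (l ++ [a]) ++ [(a, b)] :=
  zip_tail_append_pair l a b

theorem pathWeight_append_pair (W : V × V → ℝ) (l : List V) (a b : V) :
    pathWeight W (l ++ [a, b]) = pathWeight W (l ++ [a]) * W (a, b) := by
  simp [pathWeight, pathEdges_append_pair]

theorem pathDelay_append_triple (η : ℕ → Finset (V × V)) (l : List V) (a b c : V) :
    pathDelay η (l ++ [a, b, c]) = pathDelay η (l ++ [a, b]) +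
      if slot η (b, c) ≤ slot η (a, b) then 1 else 0 := by
  have h : pathEdges (l ++ [a, b, c]) = pathEdges (l ++ [a]) ++ [(a, b), (b, c)] := by
    have := pathEdges_append_pair (l ++ [a]) b c
    simp only [List.append_assoc, List.cons_append, List.nil_append] at this
    rw [this, pathEdges_append_pair, List.append_assoc]
    rfl
  simp only [pathDelay, h, pathEdges_append_pair, List.map_append, List.map_cons, List.map_nil,
    zip_tail_append_pair, List.countP_append, List.countP_singleton, decide_eq_true_eq, add_assoc]

theorem exists_eq_append_of_mem_walks {S : Set (V × V)} {a b : V} {ρ : List V}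
    (h : ρ ∈ walks S a b) : ∃ l, ρ = l ++ [b] :=
  List.getLast?_eq_some_iff.1 h.2.1

theorem append_mem_walks_iff {S : Set (V × V)} {a u v w : V} {l : List V} :
    l ++ [u, v] ∈ walks S a w ↔ l ++ [u] ∈ walks S a u ∧ (u, v) ∈ S ∧ v = w := by
  have h : (l ++ [u, v]).head? = (l ++ [u]).head? := by cases l <;> rfl
  simp only [walks, Set.mem_ofPred_eq, h, List.isChain_append_cons_cons]
  simp
  tauto

theorem chi_eq_walks {η : ℕ → Finset (V × V)} {a b : V} (hab : b ≠ a) :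
    chi η a b = walks (schedUnion η) a b := by
  ext ρ
  refine ⟨fun h => ⟨h.1, h.2.1, h.2.2.2⟩, fun h => ⟨h.1, h.2.1, ?_, h.2.2⟩⟩
  obtain ⟨h₁, h₂, -⟩ := h
  rcases ρ with _ | ⟨x, _ | ⟨y, l⟩⟩
  · simp at h₁
  · simp_all
  · simp

theorem not_transGen_self {S : Set (V × V)} (hS : ∀ v ρ, ¬ IsPathIn S v v ρ) (v : V) :
    ¬ Relation.TransGen (fun u v => (u, v) ∈ S) v v := by
  intro h
  obtain ⟨w, hvw, hwv⟩ := Relation.TransGen.head'_iff.1 h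
  obtain ⟨l, hl, hlast⟩ := List.exists_isChain_cons_of_relationReflTransGen hwv
  refine hS v (v :: w :: l) ⟨rfl, ?_, by simp, List.isChain_cons_cons.2 ⟨hvw, hl⟩⟩
  rw [List.getLast?_cons_cons, List.getLast?_eq_some_getLast (by simp), hlast]

theorem walks_self {S : Set (V × V)} (hS : ∀ v ρ, ¬ IsPathIn S v v ρ) (v : V) :
    walks S v v = {[v]} := by
  ext ρ
  constructor
  · rintro ⟨h₁, h₂, h₃⟩
    rcases ρ with _ | ⟨x, _ | ⟨y, l⟩⟩
    · simp at h₁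
    · simp_all
    · exact (hS v _ ⟨h₁, h₂, by simp, h₃⟩).elim
  · rintro rfl
    simp [walks]

theorem finite_walks [Fintype V] [DecidableEq V] {S : Set (V × V)}
    (hS : ∀ v ρ, ¬ IsPathIn S v v ρ) (a b : V) : (walks S a b).Finite := by
  have : Finite {l : List V | l.Nodup} :=
    inferInstanceAs (Finite {l : List V // l.Nodup})
  refine (Set.toFinite {l : List V | l.Nodup}).subset fun ρ hρ => ?_
  have h : ρ.IsChain (Relation.TransGen fun u v => (u, v) ∈ S) :=
    hρ.2.2.imp fun _ _ => Relation.TransGen.single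
  refine (List.isChain_iff_pairwise.1 h).imp fun {x y} hxy => ?_
  rintro rfl
  exact not_transGen_self hS x hxy

theorem walks_eq_iUnion {S : Set (V × V)} {a v : V} (hv : v ≠ a) :
    walks S a v = ⋃ u ∈ {u | (u, v) ∈ S}, (· ++ [v]) '' walks S a u := by
  ext ρ
  simp only [Set.mem_iUnion, Set.mem_image, Set.mem_ofPred_eq, exists_prop]
  constructor
  · intro h
    obtain ⟨l, rfl⟩ := exists_eq_append_of_mem_walks h
    rcases List.eq_nil_or_concat' l with rfl | ⟨l, u, rfl⟩
    · exact (hv (by simpa using h.1)).elim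
    · rw [List.append_assoc] at h
      obtain ⟨h₁, h₂, -⟩ := append_mem_walks_iff.1 h
      exact ⟨u, h₂, _, h₁, rfl⟩
  · rintro ⟨u, hu, ρ, hρ, rfl⟩
    obtain ⟨l, rfl⟩ := exists_eq_append_of_mem_walks hρ
    rw [List.append_assoc]
    exact append_mem_walks_iff.2 ⟨hρ, hu, rfl⟩

theorem finsum_walks_eq_sum [Fintype V] [DecidableEq V] {S : Set (V × V)} [DecidablePred (· ∈ S)]
    {E : Finset (V × V)} (hSE : S ⊆ E) (hS : ∀ v ρ, ¬ IsPathIn S v v ρ) {a v : V} (hv : v ≠ a)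
    (g : List V → ℝ) :
    ∑ᶠ ρ ∈ walks S a v, g ρ = ∑ u with (u, v) ∈ E,
      if (u, v) ∈ S then ∑ᶠ ρ ∈ walks S a u, g (ρ ++ [v]) else 0 := by
  rw [walks_eq_iUnion hv, finsum_mem_biUnion _ (Set.toFinite _)
    fun u _ => (finite_walks hS a u).image _]
  · rw [finsum_mem_eq_finite_toFinset_sum _ (Set.toFinite _), ← Finset.sum_filter]
    refine Finset.sum_congr ?_ fun u _ => finsum_mem_image (List.append_left_injective _).injOn
    ext u
    simpa using fun h => hSE h
  · intro u _ u' _ huu'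
    refine Set.disjoint_left.2 ?_
    rintro _ ⟨ρ, hρ, rfl⟩ ⟨ρ', hρ', h⟩
    obtain rfl : ρ' = ρ := List.append_left_injective _ h
    exact huu' (Option.some_injective _ (hρ.2.1.symm.trans hρ'.2.1))

/-- Number of times at which slot `t` of a period has been completed before the global time `h`. -/
def completed (Per h t : ℕ) : ℕ := h / Per + if t ≤ h % Per then 1 else 0

theorem completed_succ {Per h t : ℕ} (ht : 1 ≤ t) (ht' : t ≤ Per) :
    completed Per (h + 1) t = completed Per h t + if t = h % Per + 1 then 1 else 0 := by
  have hP : 0 < Per := by omega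
  obtain ⟨q, r, hr, rfl⟩ : ∃ q r, r < Per ∧ h = r + Per * q :=
    ⟨h / Per, h % Per, Nat.mod_lt h hP, (Nat.mod_add_div h Per).symm⟩
  have hr' : (r + Per * q) % Per = r := by rw [Nat.add_mul_mod_self_left, Nat.mod_eq_of_lt hr]
  rw [completed, completed, hr', add_right_comm r, Nat.add_mul_div_left _ _ hP,
    Nat.add_mul_div_left _ _ hP, Nat.add_mul_mod_self_left, Nat.div_eq_of_lt hr]
  rcases Nat.lt_or_ge (r + 1) Per with hs | hs
  · rw [Nat.div_eq_of_lt hs, Nat.mod_eq_of_lt hs]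
    split_ifs <;> omega
  · obtain rfl : Per = r + 1 := by omega
    rw [Nat.div_self hP, Nat.mod_self]
    split_ifs <;> omega

theorem slot_eq {E : Finset (V × V)} {Per : ℕ} {η : ℕ → Finset (V × V)}
    (hη : ValidSched E Per η) {e : V × V} {t : ℕ} (he : e ∈ η t) : slot η e = t := by
  have : {k | e ∈ η k} = {t} := by
    ext k
    exact ⟨fun hk => hη.2.2 e k t hk he, by rintro rfl; exact he⟩
  simp [slot, this]

theorem schedUnion_subset {E : Finset (V × V)} {Per : ℕ} {η : ℕ → Finset (V × V)}
    (hη : ValidSched E Per η) : schedUnion η ⊆ E :=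
  Set.iUnion_subset fun k => Finset.coe_subset.2 (hη.1 k)

theorem not_isPathIn_schedUnion_self [Fintype V] [DecidableEq V] (G : RadioGraph V) {Per : ℕ}
    {η : ℕ → Finset (V × V)} (hη : ValidSched G.E Per η) (v : V) (ρ : List V) :
    ¬ IsPathIn (schedUnion η) v v ρ := fun hρ =>
  G.acyclic v ρ ⟨hρ.1, hρ.2.1, hρ.2.2.1,
    List.IsChain.imp (fun _ _ hab => schedUnion_subset hη hab) hρ.2.2.2⟩

open Classical in
theorem flow_eq_finsum [Fintype V] [DecidableEq V] (G : RadioGraph V) {Per : ℕ}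
    {η : ℕ → Finset (V × V)} (hη : ValidSched G.E Per η)
    {ut : ℤ → ℝ} (hut : ∀ k : ℤ, k < 0 → ut k = 0) (h : ℕ) (u v : V) :
    flow G.E G.W Per η G.vsrc ut h (u, v) =
      if (u, v) ∈ schedUnion η then ∑ᶠ ρ ∈ walks (schedUnion η) G.vsrc u,
        pathWeight G.W (ρ ++ [v]) *
          ut (completed Per h (slot η (u, v)) - pathDelay η (ρ ++ [v]))
      else 0 := by
  have hsub := schedUnion_subset hη
  have hacyc := not_isPathIn_schedUnion_self G hη
  have hrange : ∀ {e : V × V} {t : ℕ}, e ∈ η t → 1 ≤ t ∧ t ≤ Per := fun he =>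
    hη.2.1 _ (Finset.ne_empty_of_mem he)
  induction h generalizing u v with
  | zero =>
    split_ifs with huv
    · obtain ⟨t, ht⟩ := Set.mem_iUnion.1 huv
      have := (hrange ht).1
      refine (finsum_mem_eq_zero_of_forall_eq_zero fun ρ _ => ?_).symm
      rw [slot_eq hη ht, hut, mul_zero]
      have : ¬ t ≤ 0 := by omega
      simp [completed, pathDelay, this]
      omega
    · rfl
  | succ h ih =>
    rw [flow]
    beta_reduce
    by_cases he : (u, v) ∈ η (h % Per + 1)
    · have huv : (u, v) ∈ schedUnion η := Set.mem_iUnion.2 ⟨_, he⟩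
      rw [if_pos he, if_pos huv]
      by_cases hu : u = G.vsrc
      · subst hu
        rw [if_pos rfl, walks_self hacyc, finsum_mem_singleton, slot_eq hη he,
          completed_succ (hrange he).1 (hrange he).2]
        simp [pathWeight, pathDelay, pathEdges, completed]
      rw [if_neg hu, finsum_walks_eq_sum hsub hacyc hu, Finset.mul_sum]
      refine Finset.sum_congr rfl fun w _ => ?_
      rw [ih]
      split_ifs with hwu
      · rw [mul_finsum_mem]
        refine finsum_mem_congr rfl fun ρ hρ => ?_
        obtain ⟨l, rfl⟩ := exists_eq_append_of_mem_walks hρ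
        obtain ⟨t, ht⟩ := Set.mem_iUnion.1 hwu
        have hW := pathWeight_append_pair G.W (l ++ [w]) u v
        simp only [List.append_assoc, List.cons_append, List.nil_append] at hW ⊢
        rw [hW, pathDelay_append_triple, slot_eq hη he, slot_eq hη ht,
          completed_succ (hrange he).1 (hrange he).2, mul_left_comm, mul_assoc]
        congr 3
        unfold completed
        split_ifs <;> omega
      · simp
    · rw [if_neg he, ih]
      split_ifs with huv
      · obtain ⟨t, ht⟩ := Set.mem_iUnion.1 huv
        have hne : t ≠ h % Per + 1 := fun hc => he (hc ▸ ht)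
        rw [slot_eq hη ht, completed_succ (hrange ht).1 (hrange ht).2, if_neg hne, add_zero]
      · rfl

end MCNPaper

namespace MCNPaper

/-- with all node variables initialized to `0` and `ũ(kT) = 0` for
`k < 0`, at the end of each scheduling period every node's variable equals the sum of
the contributions of all paths from the controller node to it:
`μ_j(kT) = Σ_ρ W_R(ρ)·ũ((k − δ_R(ρ))T)`, the sum ranging over all paths `ρ` from `v_c`
to `v_j` in `G_R(η_R)`. -/
theorem node_value_path_sum {V : Type} [Fintype V] [DecidableEq V]
    (G : RadioGraph V) (Per : ℕ) (hPer : 0 < Per)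
    (η : ℕ → Finset (V × V)) (hη : ValidSched G.E Per η)
    (Δ : ℝ) (hΔ : 0 < Δ)
    (ut : ℤ → ℝ) (hut : ∀ k : ℤ, k < 0 → ut k = 0) :
    ∀ vj : V, vj ≠ G.vsrc → ∀ k : ℕ,
      nodeVal G.E G.W Per η G.vsrc ut (k * Per) vj =
        ∑ᶠ ρ ∈ chi η G.vsrc vj,
          pathWeight G.W ρ * ut ((k : ℤ) - (pathDelay η ρ : ℤ)) := by
  classical
  intro v hv k
  have hsub := schedUnion_subset hη
  have hacyc := not_isPathIn_schedUnion_self G hη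
  rw [chi_eq_walks hv, finsum_walks_eq_sum hsub hacyc hv, nodeVal, if_neg hv]
  refine Finset.sum_congr rfl fun u _ => ?_
  rw [flow_eq_finsum G hη hut]
  split_ifs with huv
  · obtain ⟨t, ht⟩ := Set.mem_iUnion.1 huv
    have h1 := (hη.2.1 t (Finset.ne_empty_of_mem ht)).1
    have h0 : completed Per (k * Per) t = k := by
      simp [completed, Nat.mul_div_cancel _ hPer]
      omega
    rw [slot_eq hη ht, h0]
  · rfl

end MCNPaper
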